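/- Let E₁, E₃ be Banach spaces, 1 ≤ p < 2, X ∈ V^p([0,T],ℝ^n), f : E₁ → L(ℝ^n,E₁) γ-Hölder with 1 + γ > p, and set f_i(y) = f(y)(e_i) for the standard basis e_1,…,e_n of ℝ^n. Let F : E₁ → E₃ be twice continuously differentiable with DF(y)(f_i(y)) = 0 for all y ∈ E₁ and i = 1,…,n. Then F is a conserved quantity of dY = Σ_i f_i(Y)dX^i: for every solution Y, F(Y_t) = F(Y_0) for all t ∈ [0,T]. -/

import Mathlib

open Set Filter Topology

noncomputable section

/-- The `p`-variation of a path `X : ℝ → E` on the interval `[a,b]`,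
`‖X‖_{p,[a,b]} = (sup_D Σ_i ‖X_{t_{i+1}} − X_{t_i}‖^p)^(1/p)`, the supremum being taken
over all finite partitions `a = t₀ ≤ t₁ ≤ … ≤ t_k = b`. -/
def pVar {E : Type*} [NormedAddCommGroup E] (p : ℝ) (X : ℝ → E) (a b : ℝ) : ENNReal :=
  ⨆ (k : ℕ) (t : Fin (k + 1) → ℝ)
    (_ : Monotone t ∧ t 0 = a ∧ t (Fin.last k) = b),
    (∑ i : Fin k, (‖X (t i.succ) - X (t i.castSucc)‖₊ : ENNReal) ^ p) ^ (1 / p)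

/-- `X ∈ V^p([a,b],E)`: `X` is continuous on `[a,b]` and has finite `p`-variation there. -/
def MemVp {E : Type*} [NormedAddCommGroup E] (p : ℝ) (X : ℝ → E) (a b : ℝ) : Prop :=
  ContinuousOn X (Set.Icc a b) ∧ pVar p X a b < ⊤

/-- A partition `a = t₀ ≤ t₁ ≤ … ≤ t_k = b` of `[a,b]`. -/
structure YoungPartition (a b : ℝ) where
  k : ℕ
  t : Fin (k + 1) → ℝ
  mono : Monotone t
  first : t 0 = a
  last : t (Fin.last k) = b

/-- The mesh of a partition. -/
def YoungPartition.mesh {a b : ℝ} (D : YoungPartition a b) : ℝ :=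
  ⨆ i : Fin D.k, (D.t i.succ - D.t i.castSucc)

/-- The Riemann sum `Σ_i Z_{t_i}(X_{t_{i+1}} − X_{t_i})` along a partition. -/
def riemannSum {E F : Type*} [NormedAddCommGroup E] [NormedSpace ℝ E]
    [NormedAddCommGroup F] [NormedSpace ℝ F]
    (Z : ℝ → E →L[ℝ] F) (X : ℝ → E) {a b : ℝ} (D : YoungPartition a b) : F :=
  ∑ i : Fin D.k, Z (D.t i.castSucc) (X (D.t i.succ) - X (D.t i.castSucc))

/-- `IsYoungIntegral Z X a b I` : the Riemann sums of `Z` against `X` over partitions of `[a,b]`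
converge to `I` as the mesh tends to `0`; i.e. the Young integral `∫_a^b Z dX` exists and
equals `I`. -/
def IsYoungIntegral {E F : Type*} [NormedAddCommGroup E] [NormedSpace ℝ E]
    [NormedAddCommGroup F] [NormedSpace ℝ F]
    (Z : ℝ → E →L[ℝ] F) (X : ℝ → E) (a b : ℝ) (I : F) : Prop :=
  Filter.Tendsto (fun D : YoungPartition a b => riemannSum Z X D)
    (Filter.comap YoungPartition.mesh (nhds 0)) (nhds I)

/-- View a vector `v : E` as the continuous linear map `ℝ →L[ℝ] E`, `c ↦ c • v`; used to
integrate vector-valued integrands against scalar integrators. -/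
def toCLM {E : Type*} [NormedAddCommGroup E] [NormedSpace ℝ E] (v : E) : ℝ →L[ℝ] E :=
  (1 : ℝ →L[ℝ] ℝ).smulRight v

/-- The `α`-Hölder seminorm `‖X‖_{α;H} = sup_{s ≠ t ∈ [a,b]} ‖X_t − X_s‖ / |t−s|^α` of a path. -/
def holderSemiPath {E : Type*} [NormedAddCommGroup E] (α : ℝ) (X : ℝ → E) (a b : ℝ) : ENNReal :=
  ⨆ (s : Set.Icc a b) (t : Set.Icc a b) (_ : (s : ℝ) ≠ (t : ℝ)),
    (‖X (t : ℝ) - X (s : ℝ)‖₊ : ENNReal) / edist (s : ℝ) (t : ℝ) ^ α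

/-- The `α`-Hölder norm (sup norm plus Hölder seminorm) of a path on `[a,b]`. -/
def holderNormPath {E : Type*} [NormedAddCommGroup E] (α : ℝ) (X : ℝ → E) (a b : ℝ) : ENNReal :=
  (⨆ t : Set.Icc a b, (‖X (t : ℝ)‖₊ : ENNReal)) + holderSemiPath α X a b

/-- The `γ`-Hölder constant `‖f‖_{γ,H} = sup_{x ≠ y} ‖f x − f y‖ / ‖x − y‖^γ` of a map
between normed spaces. -/
def holderConst {E F : Type*} [NormedAddCommGroup E] [NormedAddCommGroup F]
    (γ : ℝ) (f : E → F) : ENNReal :=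
  ⨆ (x : E) (y : E) (_ : x ≠ y), (‖f x - f y‖₊ : ENNReal) / (‖x - y‖₊ : ENNReal) ^ γ
/-- `Y` is a solution on `[0,T]` of the Young equation `dY = Σ_{i=1}^n f_i(Y) dX^i`
starting at `y₀`, where `f_i(y) = f(y)(e_i)` for the standard basis `e_i` of `ℝ^n` and
`X^i` are the coordinates of `X`: `Y ∈ V^p([0,T],E₁)` and
`Y_t = y₀ + Σ_i ∫_0^t f_i(Y_s) dX^i_s` (Young integrals). -/
def IsYoungSolution {n : ℕ} {E₁ : Type*} [NormedAddCommGroup E₁] [NormedSpace ℝ E₁]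
    (p T : ℝ) (X : ℝ → Fin n → ℝ) (f : E₁ → (Fin n → ℝ) →L[ℝ] E₁)
    (y₀ : E₁) (Y : ℝ → E₁) : Prop :=
  Y 0 = y₀ ∧ MemVp p Y 0 T ∧
  ∀ t ∈ Set.Icc (0 : ℝ) T, ∃ I : Fin n → E₁,
    (∀ i, IsYoungIntegral (fun s => toCLM (f (Y s) (Pi.single i 1)))
      (fun s => X s i) 0 t (I i)) ∧
    Y t = y₀ + ∑ i, I i

/-- Discrete sewing: if the germ `A` is additive up to `C * (V t - V s) ^ θ` with `θ > 1`, its sums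
along a monotone sequence differ from its values by at most `B * (V t - V s) ^ θ`. -/
theorem norm_sum_germ_sub_le {E : Type*} [NormedAddCommGroup E] {A : ℝ → ℝ → E} {V : ℝ → ℝ}
    {a b θ B C : ℝ} (hθ : 0 < θ) (hB : 0 ≤ B) (hBC : 2 * C + 2 * (1 / 2) ^ θ * B ≤ B)
    (hC : 0 ≤ C) (hV : MonotoneOn V (Icc a b)) (hA₀ : ∀ s, A s s = 0)
    (hA : ∀ s ∈ Icc a b, ∀ u ∈ Icc a b, ∀ t ∈ Icc a b, s ≤ u → u ≤ t →
      ‖A s t - A s u - A u t‖ ≤ C * (V t - V s) ^ θ)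
    {τ : ℕ → ℝ} (hτ : Monotone τ) {m n : ℕ} (hmn : m ≤ n) (hm : a ≤ τ m) (hn : τ n ≤ b) :
    ‖∑ i ∈ Finset.Ico m n, A (τ i) (τ (i + 1)) - A (τ m) (τ n)‖ ≤
      B * (V (τ n) - V (τ m)) ^ θ := by
  induction hd : n - m using Nat.strong_induction_on generalizing m n with
  | _ d ih =>
  have mem : ∀ i, m ≤ i → i ≤ n → τ i ∈ Icc a b := fun i h₁ h₂ =>
    ⟨hm.trans (hτ h₁), (hτ h₂).trans hn⟩
  have hVm : ∀ i j, m ≤ i → i ≤ j → j ≤ n → V (τ i) ≤ V (τ j) := fun i j h₁ h₂ h₃ =>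
    hV (mem i h₁ (h₂.trans h₃)) (mem j (h₁.trans h₂) h₃) (hτ h₂)
  have hω : 0 ≤ V (τ n) - V (τ m) := sub_nonneg.2 (hVm m n le_rfl hmn le_rfl)
  rcases hmn.eq_or_lt with rfl | hlt
  · simp only [Finset.Ico_self, Finset.sum_empty, hA₀, sub_zero, norm_zero]
    positivity
  set ω := V (τ n) - V (τ m)
  obtain ⟨j, hmj, hjn, hj₁, hj₂⟩ : ∃ j, m ≤ j ∧ j < n ∧ V (τ j) - V (τ m) ≤ ω / 2 ∧
      V (τ n) - V (τ (j + 1)) ≤ ω / 2 := by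
    classical
    have hex : ∃ j, m ≤ j ∧ j < n ∧ V (τ n) - V (τ (j + 1)) ≤ ω / 2 :=
      ⟨n - 1, by omega, by omega, by
        rw [Nat.sub_add_cancel (by omega)]; simp only [sub_self]; positivity⟩
    obtain ⟨h₁, h₂, h₃⟩ := Nat.find_spec hex
    refine ⟨Nat.find hex, h₁, h₂, ?_, h₃⟩
    rcases h₁.eq_or_lt with h | h
    · rw [← h]; simp only [sub_self]; positivity
    · have := Nat.find_min hex (m := Nat.find hex - 1) (by omega)
      rw [Nat.sub_add_cancel (by omega)] at this
      have h' : ¬ V (τ n) - V (τ (Nat.find hex)) ≤ ω / 2 :=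
        fun h'' => this ⟨by omega, by omega, h''⟩
      linarith
  have half : ∀ x, 0 ≤ x → x ≤ ω / 2 → x ^ θ ≤ (1 / 2) ^ θ * ω ^ θ := fun x h₀ h => by
    rw [← Real.mul_rpow (by norm_num) hω]
    exact Real.rpow_le_rpow h₀ (by linarith) hθ.le
  have e₁ := (ih (j - m) (by omega) hmj hm ((hτ hjn.le).trans hn) rfl).trans
    (mul_le_mul_of_nonneg_left (half _ (sub_nonneg.2 (hVm m j le_rfl hmj hjn.le)) hj₁) hB)
  have e₂ := (ih (n - (j + 1)) (by omega) hjn (hm.trans (hτ (by omega))) hn rfl).trans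
    (mul_le_mul_of_nonneg_left
      (half _ (sub_nonneg.2 (hVm (j + 1) n (by omega) hjn le_rfl)) hj₂) hB)
  have e₃ := hA (τ m) (mem m le_rfl hmn) (τ j) (mem j hmj hjn.le) (τ n) (mem n hmn le_rfl)
    (hτ hmj) (hτ hjn.le)
  have e₄ := (hA (τ j) (mem j hmj hjn.le) (τ (j + 1)) (mem _ (by omega) hjn) (τ n)
    (mem n hmn le_rfl) (hτ (by omega)) (hτ hjn)).trans
    (mul_le_mul_of_nonneg_left (Real.rpow_le_rpow
      (sub_nonneg.2 (hVm j n hmj hjn.le le_rfl))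
      (sub_le_sub_left (hVm m j le_rfl hmj hjn.le) _) hθ.le) hC)
  rw [← Finset.sum_Ico_consecutive _ hmj hjn.le, Finset.sum_eq_sum_Ico_succ_bot hjn]
  set S₁ := ∑ i ∈ Finset.Ico m j, A (τ i) (τ (i + 1))
  set S₂ := ∑ i ∈ Finset.Ico (j + 1) n, A (τ i) (τ (i + 1))
  have key : S₁ + (A (τ j) (τ (j + 1)) + S₂) - A (τ m) (τ n) =
      (S₁ - A (τ m) (τ j)) + (S₂ - A (τ (j + 1)) (τ n))
        - (A (τ m) (τ n) - A (τ m) (τ j) - A (τ j) (τ n))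
        - (A (τ j) (τ n) - A (τ j) (τ (j + 1)) - A (τ (j + 1)) (τ n)) := by abel
  rw [key]
  refine (norm_sub_le _ _).trans ?_
  have n₁ := norm_sub_le ((S₁ - A (τ m) (τ j)) + (S₂ - A (τ (j + 1)) (τ n)))
    (A (τ m) (τ n) - A (τ m) (τ j) - A (τ j) (τ n))
  have n₂ := norm_add_le (S₁ - A (τ m) (τ j)) (S₂ - A (τ (j + 1)) (τ n))
  have hfin := mul_le_mul_of_nonneg_right hBC (Real.rpow_nonneg hω θ)
  linarith

/-- The supremum over partitions of the sums of `p`-th powers of increments, i.e. the `p`-th power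
of the `p`-variation. -/
def powVar {E : Type*} [NormedAddCommGroup E] (p : ℝ) (X : ℝ → E) (a b : ℝ) : ENNReal :=
  ⨆ D : YoungPartition a b,
    ∑ i : Fin D.k, (‖X (D.t i.succ) - X (D.t i.castSucc)‖₊ : ENNReal) ^ p

theorem powVar_le_pVar_rpow {E : Type*} [NormedAddCommGroup E] {p : ℝ} (hp : 0 < p) (X : ℝ → E)
    (a b : ℝ) : powVar p X a b ≤ pVar p X a b ^ p := by
  refine iSup_le fun D => ?_
  rw [← ENNReal.rpow_inv_le_iff hp, ← one_div]
  unfold pVar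
  exact le_iSup₂_of_le D.k D.t (le_iSup_of_le ⟨D.mono, D.first, D.last⟩ le_rfl)

/-- Append a point to a partition. -/
def YoungPartition.snoc {a s : ℝ} (D : YoungPartition a s) {t : ℝ} (h : s ≤ t) :
    YoungPartition a t where
  k := D.k + 1
  t := Fin.snoc (α := fun _ => ℝ) D.t t
  mono := by
    have hle : ∀ i, D.t i ≤ s := fun i => (D.mono (Fin.le_last i)).trans D.last.le
    intro i j hij
    induction j using Fin.lastCases with
    | last =>
      induction i using Fin.lastCases with
      | last => rfl
      | cast i => simpa using (hle i).trans h
    | cast j =>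
      induction i using Fin.lastCases with
      | last => exact absurd hij (not_le.2 (Fin.castSucc_lt_last j))
      | cast i => simpa using D.mono (by simpa using hij)
  first := by
    have : (0 : Fin (D.k + 1 + 1)) = Fin.castSucc 0 := rfl
    rw [this, Fin.snoc_castSucc, D.first]
  last := by simp

theorem powVar_add_le {E : Type*} [NormedAddCommGroup E] {p : ℝ} (X : ℝ → E)
    {a s t : ℝ} (has : a ≤ s) (hst : s ≤ t) :
    powVar p X a s + (‖X t - X s‖₊ : ENNReal) ^ p ≤ powVar p X a t := by
  have : Nonempty (YoungPartition a s) := ⟨⟨1, ![a, s], by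
    intro i j hij
    fin_cases i <;> fin_cases j <;> simp_all, rfl, rfl⟩⟩
  unfold powVar
  rw [ENNReal.iSup_add]
  refine iSup_le fun D => le_iSup_of_le (D.snoc hst) (le_of_eq ?_)
  change _ = ∑ i : Fin (D.k + 1), _
  rw [Fin.sum_univ_castSucc]
  congr 1
  · refine Finset.sum_congr rfl fun i _ => ?_
    simp only [YoungPartition.snoc, Fin.snoc_castSucc, Fin.succ_castSucc]
  · simp only [YoungPartition.snoc, Fin.snoc_castSucc, Fin.succ_last, Fin.snoc_last, D.last]

theorem MemVp.exists_control {E : Type*} [NormedAddCommGroup E] {p : ℝ} (hp : 0 < p) {X : ℝ → E}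
    {a b : ℝ} (hX : MemVp p X a b) :
    ∃ V : ℝ → ℝ, (∀ t, 0 ≤ V t) ∧ ∀ s ∈ Icc a b, ∀ t ∈ Icc a b, s ≤ t →
      ‖X t - X s‖ ^ p ≤ V t - V s := by
  have hfin : ∀ t ∈ Icc a b, powVar p X a t ≠ ⊤ := fun t ht => by
    refine ne_top_of_le_ne_top (ENNReal.rpow_ne_top_of_nonneg hp.le hX.2.ne) ?_
    exact (le_self_add.trans (powVar_add_le X ht.1 ht.2)).trans (powVar_le_pVar_rpow hp X a b)
  refine ⟨fun t => (powVar p X a t).toReal, fun t => ENNReal.toReal_nonneg, ?_⟩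
  intro s hs t ht hst
  have h := ENNReal.toReal_mono (hfin t ht) (powVar_add_le (p := p) X hs.1 hst)
  rw [ENNReal.toReal_add (hfin s hs) (ENNReal.rpow_ne_top_of_nonneg hp.le ENNReal.coe_ne_top),
    ← ENNReal.toReal_rpow] at h
  simp only [ENNReal.coe_toReal, coe_nnnorm] at h
  linarith

/-- The partition of `[a,b]` given by the first `k` steps of a monotone sequence. -/
def YoungPartition.ofSeq {a b : ℝ} (τ : ℕ → ℝ) (k : ℕ) (hτ : Monotone τ) (h₀ : τ 0 = a)
    (hk : τ k = b) : YoungPartition a b where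
  k := k
  t i := τ i
  mono _ _ h := hτ h
  first := h₀
  last := hk

theorem riemannSum_ofSeq {E F : Type*} [NormedAddCommGroup E] [NormedSpace ℝ E]
    [NormedAddCommGroup F] [NormedSpace ℝ F] (Z : ℝ → E →L[ℝ] F) (X : ℝ → E) {a b : ℝ}
    (τ : ℕ → ℝ) (k : ℕ) (hτ : Monotone τ) (h₀ : τ 0 = a) (hk : τ k = b) :
    riemannSum Z X (.ofSeq τ k hτ h₀ hk) =
      ∑ i ∈ Finset.range k, Z (τ i) (X (τ (i + 1)) - X (τ i)) :=
  Fin.sum_univ_eq_sum_range (fun i => Z (τ i) (X (τ (i + 1)) - X (τ i))) k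

theorem IsYoungIntegral.tendsto_sum {E F : Type*} [NormedAddCommGroup E] [NormedSpace ℝ E]
    [NormedAddCommGroup F] [NormedSpace ℝ F] {Z : ℝ → E →L[ℝ] F} {X : ℝ → E} {a b : ℝ} {I : F}
    (h : IsYoungIntegral Z X a b I) {τ : ℕ → ℕ → ℝ} {k : ℕ → ℕ} (hτ : ∀ N, Monotone (τ N))
    (h₀ : ∀ N, τ N 0 = a) (hk : ∀ N, τ N (k N) = b) {r : ℕ → ℝ} (hr : Tendsto r atTop (𝓝 0))
    (hr₀ : ∀ N, 0 ≤ r N) (hmesh : ∀ N i, τ N (i + 1) - τ N i ≤ r N) :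
    Tendsto (fun N => ∑ i ∈ Finset.range (k N), Z (τ N i) (X (τ N (i + 1)) - X (τ N i)))
      atTop (𝓝 I) := by
  have hD : Tendsto (fun N => YoungPartition.ofSeq (τ N) (k N) (hτ N) (h₀ N) (hk N)) atTop
      (comap YoungPartition.mesh (𝓝 0)) := by
    rw [tendsto_comap_iff]
    refine squeeze_zero (fun N => ?_) (fun N => ?_) hr
    · exact Real.iSup_nonneg fun i => sub_nonneg.2 (hτ N (Nat.le_succ i))
    · exact Real.iSup_le (fun i => hmesh N i) (hr₀ N)
  exact (h.comp hD).congr fun N => riemannSum_ofSeq _ _ _ _ _ _ _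

/-- A sequence running from `0` to `s` and then from `s` to `t`, with `N + 1` equal steps each. -/
def twoStepSeq (s t : ℝ) (N i : ℕ) : ℝ :=
  s * (min i (N + 1) : ℕ) / (N + 1) + (t - s) * (i - (N + 1) : ℕ) / (N + 1)

theorem twoStepSeq_step {s t : ℝ} (hs : 0 ≤ s) (hst : s ≤ t) (N i : ℕ) :
    0 ≤ twoStepSeq s t N (i + 1) - twoStepSeq s t N i ∧
      twoStepSeq s t N (i + 1) - twoStepSeq s t N i ≤ t / (N + 1) := by
  have hN : (0 : ℝ) < N + 1 := by positivity
  rcases lt_or_ge i (N + 1) with h | h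
  · have e : twoStepSeq s t N (i + 1) - twoStepSeq s t N i = s / (N + 1) := by
      unfold twoStepSeq
      rw [min_eq_left h.le, min_eq_left h, Nat.sub_eq_zero_of_le h, Nat.sub_eq_zero_of_le h.le]
      push_cast
      ring
    rw [e]
    exact ⟨by positivity, by gcongr⟩
  · have e : twoStepSeq s t N (i + 1) - twoStepSeq s t N i = (t - s) / (N + 1) := by
      unfold twoStepSeq
      rw [min_eq_right h, min_eq_right (h.trans (Nat.le_succ i)), Nat.sub_add_comm h]
      push_cast
      ring
    rw [e]
    exact ⟨div_nonneg (by linarith) hN.le, by gcongr; linarith⟩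

theorem IsYoungSolution.exists_tendsto {n : ℕ} {E₁ : Type*} [NormedAddCommGroup E₁]
    [NormedSpace ℝ E₁] {p T : ℝ} {X : ℝ → Fin n → ℝ} {f : E₁ → (Fin n → ℝ) →L[ℝ] E₁} {y₀ : E₁}
    {Y : ℝ → E₁} (hY : IsYoungSolution p T X f y₀ Y) {s t : ℝ} (hs : 0 ≤ s) (hst : s ≤ t)
    (ht : t ≤ T) :
    ∃ (τ : ℕ → ℕ → ℝ) (l k : ℕ → ℕ), (∀ N, Monotone (τ N)) ∧ (∀ N, l N ≤ k N) ∧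
      (∀ N, τ N (l N) = s) ∧ (∀ N, τ N (k N) = t) ∧
      Tendsto (fun N => ∑ i ∈ Finset.Ico (l N) (k N),
        f (Y (τ N i)) (X (τ N (i + 1)) - X (τ N i))) atTop (𝓝 (Y t - Y s)) := by
  obtain ⟨I, hI, hIt⟩ := hY.2.2 t ⟨hs.trans hst, ht⟩
  obtain ⟨J, hJ, hJs⟩ := hY.2.2 s ⟨hs, hst.trans ht⟩
  have hτ : ∀ N, Monotone (twoStepSeq s t N) := fun N =>
    monotone_nat_of_le_succ fun i => sub_nonneg.1 (twoStepSeq_step hs hst N i).1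
  have h₀ : ∀ N, twoStepSeq s t N 0 = 0 := fun N => by simp [twoStepSeq]
  have hl : ∀ N, twoStepSeq s t N (N + 1) = s := fun N => by
    have : (N + 1 : ℝ) ≠ 0 := by positivity
    simp [twoStepSeq, this]
  have hk : ∀ N, twoStepSeq s t N (2 * (N + 1)) = t := fun N => by
    have : (N + 1 : ℝ) ≠ 0 := by positivity
    unfold twoStepSeq
    rw [min_eq_right (by omega), show 2 * (N + 1) - (N + 1) = N + 1 by omega]
    push_cast
    field_simp
    ring
  refine ⟨twoStepSeq s t, fun N => N + 1, fun N => 2 * (N + 1), hτ,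
    fun N => by dsimp only; omega, hl, hk, ?_⟩
  have hr : Tendsto (fun N : ℕ => t / ((N : ℝ) + 1)) atTop (𝓝 0) :=
    tendsto_const_div_atTop_nhds_zero_nat t |>.comp (tendsto_add_atTop_nat 1) |>.congr
      fun N => by simp
  have hr₀ : ∀ N : ℕ, 0 ≤ t / ((N : ℝ) + 1) := fun N =>
    div_nonneg (hs.trans hst) (by positivity)
  have hsub := (tendsto_finsetSum Finset.univ fun i _ =>
      (hI i).tendsto_sum hτ h₀ hk hr hr₀ fun N j => (twoStepSeq_step hs hst N j).2).sub
    (tendsto_finsetSum Finset.univ fun i _ =>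
      (hJ i).tendsto_sum hτ h₀ hl hr hr₀ fun N j => (twoStepSeq_step hs hst N j).2)
  rw [hIt, hJs, add_sub_add_left_eq_sub]
  refine hsub.congr fun N => ?_
  rw [← Finset.sum_sub_distrib]
  simp_rw [← Finset.sum_Ico_eq_sub _ (show N + 1 ≤ 2 * (N + 1) by omega)]
  rw [Finset.sum_comm]
  refine Finset.sum_congr rfl fun j _ => ?_
  conv_rhs => rw [← Finset.univ_sum_single
    (X (twoStepSeq s t N (j + 1)) - X (twoStepSeq s t N j)), map_sum]
  refine Finset.sum_congr rfl fun i _ => ?_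
  rw [← mul_one ((X (twoStepSeq s t N (j + 1)) - X (twoStepSeq s t N j)) i), ← smul_eq_mul,
    Pi.single_smul', map_smul]
  simp [toCLM]

/-- Along the segments joining points of a compact path, a `C²` map has uniformly bounded
derivative and a uniform second-order Taylor remainder. -/
theorem exists_taylor_bound {E₁ E₃ : Type*} [NormedAddCommGroup E₁] [NormedSpace ℝ E₁]
    [NormedAddCommGroup E₃] [NormedSpace ℝ E₃] {F : E₁ → E₃} (hF : ContDiff ℝ 2 F)
    {Y : ℝ → E₁} {a b : ℝ} (hY : ContinuousOn Y (Icc a b)) :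
    ∃ L M : ℝ, ∀ s ∈ Icc a b, ∀ t ∈ Icc a b, ‖fderiv ℝ F (Y s)‖ ≤ L ∧
      ‖F (Y t) - F (Y s) - fderiv ℝ F (Y s) (Y t - Y s)‖ ≤ M * ‖Y t - Y s‖ ^ 2 := by
  have hK : IsCompact ((fun q : ℝ × ℝ × ℝ => Y q.2.1 + q.1 • (Y q.2.2 - Y q.2.1)) ''
      (Icc (0 : ℝ) 1 ×ˢ Icc a b ×ˢ Icc a b)) := by
    refine (isCompact_Icc.prod (isCompact_Icc.prod isCompact_Icc)).image_of_continuousOn ?_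
    have h₁ : ContinuousOn (fun q : ℝ × ℝ × ℝ => Y q.2.1)
        (Icc (0 : ℝ) 1 ×ˢ Icc a b ×ˢ Icc a b) :=
      hY.comp (by fun_prop) fun q hq => hq.2.1
    have h₂ : ContinuousOn (fun q : ℝ × ℝ × ℝ => Y q.2.2)
        (Icc (0 : ℝ) 1 ×ˢ Icc a b ×ˢ Icc a b) :=
      hY.comp (by fun_prop) fun q hq => hq.2.2
    exact h₁.add (continuousOn_fst.smul (h₂.sub h₁))
  have hseg : ∀ s ∈ Icc a b, ∀ t ∈ Icc a b, segment ℝ (Y s) (Y t) ⊆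
      (fun q : ℝ × ℝ × ℝ => Y q.2.1 + q.1 • (Y q.2.2 - Y q.2.1)) ''
      (Icc (0 : ℝ) 1 ×ˢ Icc a b ×ˢ Icc a b) := by
    intro s hs t ht z hz
    rw [segment_eq_image'] at hz
    obtain ⟨l, hl, rfl⟩ := hz
    exact ⟨(l, s, t), ⟨hl, hs, ht⟩, rfl⟩
  have hF' : ContDiff ℝ 1 (fderiv ℝ F) := hF.fderiv_right (by norm_num)
  obtain ⟨L, hL⟩ := hK.exists_bound_of_continuousOn hF'.continuous.continuousOn
  obtain ⟨M, hM⟩ := hK.exists_bound_of_continuousOn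
    (hF'.continuous_fderiv (by norm_num)).continuousOn
  refine ⟨L, M, fun s hs t ht => ⟨hL _ (hseg s hs t ht (left_mem_segment ℝ _ _)), ?_⟩⟩
  have hM₀ : 0 ≤ M := (norm_nonneg _).trans (hM _ (hseg s hs t ht (left_mem_segment ℝ _ _)))
  have h₁ : ∀ z ∈ segment ℝ (Y s) (Y t),
      ‖fderiv ℝ F z - fderiv ℝ F (Y s)‖ ≤ M * ‖Y t - Y s‖ := fun z hz => by
    refine ((convex_segment (Y s) (Y t)).norm_image_sub_le_of_norm_fderiv_le
      (fun x _ => hF'.differentiable (by norm_num) x) (fun x hx => hM x (hseg s hs t ht hx))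
      (left_mem_segment ℝ _ _) hz).trans ?_
    exact mul_le_mul_of_nonneg_left (norm_sub_le_of_mem_segment hz) hM₀
  have h₂ := (convex_segment (Y s) (Y t)).norm_image_sub_le_of_norm_fderiv_le'
    (fun x _ => hF.differentiable (by norm_num) x) h₁ (left_mem_segment ℝ _ _)
    (right_mem_segment ℝ _ _)
  rwa [mul_assoc, ← sq] at h₂

/-- Local bounds of the increments of `g` by those of a function `V` chain to a global bound. -/
theorem norm_sub_le_of_local {E : Type*} [NormedAddCommGroup E] {g : ℝ → E} {V : ℝ → ℝ}
    {T δ G : ℝ} (hδ : 0 < δ)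
    (h : ∀ s ∈ Icc 0 T, ∀ t ∈ Icc 0 T, s ≤ t → t - s ≤ δ → ‖g t - g s‖ ≤ G * (V t - V s))
    {t : ℝ} (ht : t ∈ Icc 0 T) : ‖g t - g 0‖ ≤ G * (V t - V 0) := by
  obtain ⟨N, hN⟩ := exists_nat_gt (t / δ)
  have hN₀ : (0 : ℝ) < N := (div_nonneg ht.1 hδ.le).trans_lt hN
  have hstep : t / N ≤ δ := by
    rw [div_le_iff₀ hN₀]
    rw [div_lt_iff₀ hδ] at hN
    linarith
  have hmem : ∀ i : ℕ, i ≤ N → t * i / N ∈ Icc 0 T := fun i hi => by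
    refine ⟨div_nonneg (mul_nonneg ht.1 (by positivity)) hN₀.le, le_trans ?_ ht.2⟩
    rw [div_le_iff₀ hN₀]
    exact mul_le_mul_of_nonneg_left (by exact_mod_cast hi) ht.1
  have key : ∀ i : ℕ, i ≤ N → ‖g (t * i / N) - g 0‖ ≤ G * (V (t * i / N) - V 0) := by
    intro i
    induction i with
    | zero => simp
    | succ i ih =>
      intro hi
      have e : t * (i + 1 : ℕ) / N - t * i / N = t / N := by push_cast; ring
      have h₁ := h _ (hmem i (by omega)) _ (hmem (i + 1) hi)
        (by rw [← sub_nonneg, e]; exact div_nonneg ht.1 hN₀.le) (e.trans_le hstep)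
      have h₂ := norm_sub_le_norm_sub_add_norm_sub (g (t * (i + 1 : ℕ) / N)) (g (t * i / N)) (g 0)
      have h₃ := ih (by omega)
      linarith
  simpa [hN₀.ne'] using key N le_rfl

/-- If `DF(y)(f_i(y)) = 0` for all `y` and `i`, then `F` is a conserved quantity of
`dY = Σ_i f_i(Y)dX^i`: for every solution `Y`, `F(Y_t) = F(Y_0)` for all `t ∈ [0,T]`. -/
theorem conserved_quantity_young_coordinates
    {n : ℕ} {E₁ E₃ : Type*} [NormedAddCommGroup E₁] [NormedSpace ℝ E₁] [CompleteSpace E₁]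
    [NormedAddCommGroup E₃] [NormedSpace ℝ E₃] [CompleteSpace E₃]
    (p γ T : ℝ) (hp1 : 1 ≤ p) (hp2 : p < 2) (hγ0 : 0 < γ) (hγ1 : γ ≤ 1)
    (hγp : 1 + γ > p) (hT : 0 ≤ T)
    (X : ℝ → Fin n → ℝ) (hX : MemVp p X 0 T)
    (f : E₁ → (Fin n → ℝ) →L[ℝ] E₁)
    (hf : ∃ C : ℝ, ∀ x y : E₁, ‖f x - f y‖ ≤ C * ‖x - y‖ ^ γ)
    (F : E₁ → E₃) (hF : ContDiff ℝ 2 F)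
    (hDF : ∀ (y : E₁) (i : Fin n), fderiv ℝ F y (f y (Pi.single i 1)) = 0)
    (y₀ : E₁) (Y : ℝ → E₁) (hY : IsYoungSolution p T X f y₀ Y) :
    ∀ t ∈ Set.Icc (0 : ℝ) T, F (Y t) = F (Y 0) := by
  obtain ⟨C, hC⟩ := hf
  obtain ⟨VX, hVX₀, hVX⟩ := hX.exists_control (by linarith)
  obtain ⟨VY, hVY₀, hVY⟩ := hY.2.1.exists_control (by linarith)
  obtain ⟨L, M, hLM⟩ := exists_taylor_bound hF hY.2.1.1
  set V : ℝ → ℝ := fun t => VX t + VY t with hVdef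
  have hp0 : 0 < p := by linarith
  have h0T : (0 : ℝ) ∈ Icc 0 T := ⟨le_rfl, hT⟩
  have hXV : ∀ s ∈ Icc 0 T, ∀ t ∈ Icc 0 T, s ≤ t → ‖X t - X s‖ ^ p ≤ V t - V s :=
    fun s hs t ht hst => by
      have h₁ := hVX s hs t ht hst
      have h₂ := (Real.rpow_nonneg (norm_nonneg _) p).trans (hVY s hs t ht hst)
      simp only [hVdef]; linarith
  have hYV : ∀ s ∈ Icc 0 T, ∀ t ∈ Icc 0 T, s ≤ t → ‖Y t - Y s‖ ^ p ≤ V t - V s :=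
    fun s hs t ht hst => by
      have h₁ := hVY s hs t ht hst
      have h₂ := (Real.rpow_nonneg (norm_nonneg _) p).trans (hVX s hs t ht hst)
      simp only [hVdef]; linarith
  have hVmono : MonotoneOn V (Icc 0 T) := fun s hs t ht hst =>
    sub_nonneg.1 ((Real.rpow_nonneg (norm_nonneg _) p).trans (hXV s hs t ht hst))
  have hV₀ : ∀ t, 0 ≤ V t := fun t => add_nonneg (hVX₀ t) (hVY₀ t)
  have hL₀ : 0 ≤ L := (norm_nonneg _).trans (hLM 0 h0T 0 h0T).1
  -- part of the regularity is given up, to gain a small factor from uniform continuity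
  set η : ℝ := (1 + γ - p) / 2 with hη
  set θ : ℝ := (1 + γ - η) / p with hθ
  have hη0 : 0 < η := by rw [hη]; linarith
  have hθ1 : 1 < θ := by rw [hθ, lt_div_iff₀ hp0]; linarith
  have hhalf : 2 * (1 / 2 : ℝ) ^ θ < 1 := by
    have := Real.rpow_lt_rpow_of_exponent_gt (x := (1 / 2 : ℝ)) (by norm_num) (by norm_num) hθ1
    rw [Real.rpow_one] at this
    linarith
  set B : ℝ := 2 * |C| / (1 - 2 * (1 / 2) ^ θ) with hB
  have hB₀ : 0 ≤ B := div_nonneg (by positivity) (by linarith)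
  have hBeq : B * (1 - 2 * (1 / 2) ^ θ) = 2 * |C| := div_mul_cancel₀ _ (by linarith)
  have main : ∀ ε > 0, ∀ t ∈ Icc 0 T, ‖F (Y t) - F (Y 0)‖ ≤
      (L * (B * ε ^ η * V T ^ (θ - 1)) + |M| * ε ^ (2 - p)) * (V t - V 0) := by
    intro ε hε t ht
    obtain ⟨δ, hδ, hYδ⟩ := Metric.uniformContinuousOn_iff_le.1
      (isCompact_Icc.uniformContinuousOn_of_continuous hY.2.1.1) ε hε
    refine norm_sub_le_of_local (g := fun t => F (Y t)) hδ (fun s hs t ht hst hd => ?_) ht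
    have hω : 0 ≤ V t - V s := sub_nonneg.2 (hVmono hs ht hst)
    have hsub : Icc s t ⊆ Icc 0 T := Icc_subset_Icc hs.1 ht.2
    have hYε : ∀ u ∈ Icc s t, ∀ v ∈ Icc s t, ‖Y v - Y u‖ ≤ ε := fun u hu v hv => by
      rw [← dist_eq_norm]
      refine hYδ v (hsub hv) u (hsub hu) ?_
      rw [Real.dist_eq, abs_le]
      constructor <;> linarith [hu.1, hu.2, hv.1, hv.2]
    have hgerm : ∀ u ∈ Icc s t, ∀ v ∈ Icc s t, ∀ w ∈ Icc s t, u ≤ v → v ≤ w →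
        ‖f (Y u) (X w - X u) - f (Y u) (X v - X u) - f (Y v) (X w - X v)‖ ≤
          |C| * ε ^ η * (V w - V u) ^ θ := by
      intro u hu v hv w hw huv hvw
      have e : f (Y u) (X w - X u) - f (Y u) (X v - X u) - f (Y v) (X w - X v) =
          (f (Y u) - f (Y v)) (X w - X v) := by
        rw [← map_sub, sub_sub_sub_cancel_right, sub_apply]
      have hw₀ : 0 ≤ V w - V u := sub_nonneg.2 (hVmono (hsub hu) (hsub hw) (huv.trans hvw))
      have hx : ‖X w - X v‖ ≤ (V w - V u) ^ p⁻¹ := by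
        rw [Real.le_rpow_inv_iff_of_pos (norm_nonneg _) hw₀ hp0]
        linarith [hXV v (hsub hv) w (hsub hw) hvw, hVmono (hsub hu) (hsub hv) huv]
      have hy : ‖Y v - Y u‖ ≤ (V w - V u) ^ p⁻¹ := by
        rw [Real.le_rpow_inv_iff_of_pos (norm_nonneg _) hw₀ hp0]
        linarith [hYV u (hsub hu) v (hsub hv) huv, hVmono (hsub hv) (hsub hw) hvw]
      have hγη : 0 < γ - η := by rw [hη]; linarith
      have hyγ : ‖Y u - Y v‖ ^ γ ≤ ε ^ η * (V w - V u) ^ ((γ - η) / p) := by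
        rw [norm_sub_rev, show γ = η + (γ - η) by ring,
          Real.rpow_add_of_nonneg (norm_nonneg _) hη0.le hγη.le, add_sub_cancel]
        refine mul_le_mul (Real.rpow_le_rpow (norm_nonneg _) (hYε u hu v hv) hη0.le) ?_
          (by positivity) (by positivity)
        refine (Real.rpow_le_rpow (norm_nonneg _) hy hγη.le).trans_eq ?_
        rw [← Real.rpow_mul hw₀]
        congr 1
        ring
      have hsplit : (V w - V u) ^ θ = (V w - V u) ^ ((γ - η) / p) * (V w - V u) ^ p⁻¹ := by
        rw [← Real.rpow_add_of_nonneg hw₀ (by positivity) (by positivity)]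
        congr 1
        rw [hθ]
        ring
      rw [e, hsplit]
      calc ‖(f (Y u) - f (Y v)) (X w - X v)‖
          ≤ ‖f (Y u) - f (Y v)‖ * ‖X w - X v‖ := ContinuousLinearMap.le_opNorm _ _
        _ ≤ (|C| * (ε ^ η * (V w - V u) ^ ((γ - η) / p))) * (V w - V u) ^ p⁻¹ := by
            refine mul_le_mul ((hC _ _).trans ?_) hx (norm_nonneg _) (by positivity)
            exact mul_le_mul (le_abs_self C) hyγ (by positivity) (abs_nonneg C)
        _ = _ := by ring
    have hsew : ‖Y t - Y s - f (Y s) (X t - X s)‖ ≤ B * ε ^ η * (V t - V s) ^ θ := by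
      obtain ⟨τ, l, k, hτ, hlk, hl, hk, hlim⟩ := hY.exists_tendsto hs.1 hst ht.2
      refine le_of_tendsto (hlim.sub_const _).norm (Eventually.of_forall fun N => ?_)
      have h := norm_sum_germ_sub_le (A := fun u v => f (Y u) (X v - X u)) (B := B * ε ^ η)
        (by linarith) (by positivity) (by linear_combination -(ε ^ η) * hBeq)
        (by positivity) (hVmono.mono hsub) (fun u => by simp) hgerm
        (hτ N) (hlk N) (hl N).ge (hk N).le
      simpa only [hl, hk] using h
    have hann : fderiv ℝ F (Y s) (f (Y s) (X t - X s)) = 0 := by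
      rw [← Finset.univ_sum_single (X t - X s), map_sum, map_sum]
      refine Finset.sum_eq_zero fun i _ => ?_
      rw [← mul_one ((X t - X s) i), ← smul_eq_mul, Pi.single_smul', map_smul, map_smul, hDF,
        smul_zero]
    have hlin : ‖fderiv ℝ F (Y s) (Y t - Y s)‖ ≤
        L * (B * ε ^ η * V T ^ (θ - 1)) * (V t - V s) := by
      have hpow : (V t - V s) ^ θ ≤ V T ^ (θ - 1) * (V t - V s) := by
        rw [show θ = (θ - 1) + 1 by ring,
          Real.rpow_add_of_nonneg hω (by linarith) zero_le_one, Real.rpow_one, add_sub_cancel_right]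
        refine mul_le_mul_of_nonneg_right (Real.rpow_le_rpow hω ?_ (by linarith)) hω
        linarith [hV₀ s, hVmono ht ⟨hT, le_rfl⟩ ht.2]
      rw [← sub_zero (fderiv ℝ F (Y s) (Y t - Y s)), ← hann, ← map_sub]
      calc _ ≤ L * (B * ε ^ η * (V t - V s) ^ θ) :=
            (ContinuousLinearMap.le_opNorm _ _).trans
              (mul_le_mul (hLM s hs t ht).1 hsew (norm_nonneg _) hL₀)
        _ ≤ L * (B * ε ^ η * (V T ^ (θ - 1) * (V t - V s))) := by gcongr
        _ = _ := by ring
    have hquad : M * ‖Y t - Y s‖ ^ 2 ≤ |M| * ε ^ (2 - p) * (V t - V s) := by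
      have hsq : ‖Y t - Y s‖ ^ 2 = ‖Y t - Y s‖ ^ (2 - p) * ‖Y t - Y s‖ ^ p := by
        rw [← Real.rpow_add_of_nonneg (norm_nonneg _) (by linarith) hp0.le, sub_add_cancel,
          Real.rpow_two]
      rw [hsq, mul_assoc]
      refine mul_le_mul (le_abs_self M) ?_ (by positivity) (abs_nonneg M)
      exact mul_le_mul (Real.rpow_le_rpow (norm_nonneg _)
        (hYε s ⟨le_rfl, hst⟩ t ⟨hst, le_rfl⟩) (by linarith)) (hYV s hs t ht hst)
        (by positivity) (by positivity)
    have htri := norm_le_norm_sub_add (F (Y t) - F (Y s)) (fderiv ℝ F (Y s) (Y t - Y s))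
    have := (hLM s hs t ht).2
    linarith
  intro t ht
  have hlim : Tendsto (fun ε : ℝ =>
      (L * (B * ε ^ η * V T ^ (θ - 1)) + |M| * ε ^ (2 - p)) * (V t - V 0)) (𝓝[>] 0) (𝓝 0) := by
    have hc : Continuous fun ε : ℝ =>
        (L * (B * ε ^ η * V T ^ (θ - 1)) + |M| * ε ^ (2 - p)) * (V t - V 0) := by
      have h₁ := Real.continuous_rpow_const hη0.le
      have h₂ := Real.continuous_rpow_const (q := 2 - p) (by linarith)
      fun_prop
    refine (hc.tendsto' 0 0 ?_).mono_left nhdsWithin_le_nhds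
    rw [Real.zero_rpow hη0.ne', Real.zero_rpow (by linarith)]
    ring
  have hle : ‖F (Y t) - F (Y 0)‖ ≤ 0 := ge_of_tendsto hlim
    (eventually_mem_nhdsWithin.mono fun ε hε => main ε hε t ht)
  exact sub_eq_zero.1 (norm_le_zero_iff.1 hle)
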